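/- 𝒫' is an open subset of X, and 𝒫' ∩ B is dense in B. -/

import Mathlib

/-- `ℤⁿ_♯`: nonzero integer vectors whose first nonzero component is positive. -/
def ZSharp {n : ℕ} (k : Fin n → ℤ) : Prop :=
  ∃ j, 0 < k j ∧ ∀ i, i < j → k i = 0

/-- `ℤⁿ_*`: generators of one-dimensional maximal lattices. -/
def ZStar {n : ℕ} (k : Fin n → ℤ) : Prop :=
  ZSharp k ∧ Finset.univ.gcd k = 1

/-- The 1-norm `|k|₁ = ∑ |k_i|` of an integer vector. -/
def onormZ {n : ℕ} (k : Fin n → ℤ) : ℤ := ∑ i, |k i|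

lemma zsharp_smul {n : ℕ} {k : Fin n → ℤ} (hk : ZSharp k) (j : ℕ) :
    ZSharp (((j : ℤ) + 1) • k) := by
  obtain ⟨i, hi, h0⟩ := hk
  refine ⟨i, ?_, fun i' hi' => ?_⟩
  · have hj : (0 : ℤ) < (j : ℤ) + 1 := by positivity
    simpa [smul_eq_mul] using mul_pos hj hi
  · simp [smul_eq_mul, h0 i' hi']

/-- The Banach space `X` of bounded functions `ℤⁿ_♯ → ℂ` with the sup norm,
realized as `ℓ^∞`. -/
noncomputable abbrev XSp (n : ℕ) := lp (fun _ : {k : Fin n → ℤ // ZSharp k} => ℂ) ⊤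

/-- The real-analytic function `F^k_z(t) := 2 Re ∑_{j≥1} z_{jk} e^{−j|k|s} e^{ijt}`. -/
noncomputable def Fk {n : ℕ} (s : ℝ) (z : XSp n) (k : Fin n → ℤ) (hk : ZSharp k) :
    ℝ → ℝ :=
  fun t => 2 * (∑' j : ℕ,
    (z : ∀ _ : {k : Fin n → ℤ // ZSharp k}, ℂ)
        ⟨((j : ℤ) + 1) • k, zsharp_smul hk j⟩ *
      Complex.exp (((j : ℂ) + 1) *
        (-((onormZ k : ℂ)) * (s : ℂ) + Complex.I * (t : ℂ)))).re

/-- The cut-off `K_s(δ)`. -/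
noncomputable def Ks (c s δ : ℝ) : ℝ :=
  c * max 1 (max (1 / s) ((1 / s) * Real.log (1 / (s * δ))))

/-- The set `𝒫' ⊆ X` of non-degenerate potentials (with (P1′)). -/
noncomputable def Pprime (n : ℕ) (c s : ℝ) : Set (XSp n) :=
  {z | ∃ δ : ℝ, 0 < δ ∧ δ ≤ 1 ∧
    -- (P1′)
    (∀ (k : Fin n → ℤ) (hk : ZStar k), Ks c s δ < (onormZ k : ℝ) →
      δ ≤ ‖(z : ∀ _ : {k : Fin n → ℤ // ZSharp k}, ℂ) ⟨k, hk.1⟩‖) ∧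
    -- (P2)
    (∀ (k : Fin n → ℤ) (hk : ZStar k), (onormZ k : ℝ) ≤ Ks c s δ →
      ∀ t : ℝ,
        0 < |deriv (Fk s z k hk.1) t| + |deriv (deriv (Fk s z k hk.1)) t|) ∧
    -- (P3)
    (∀ (k : Fin n → ℤ) (hk : ZStar k), (onormZ k : ℝ) ≤ Ks c s δ →
      ∀ t₁ t₂ : ℝ, 0 ≤ t₁ → t₁ < t₂ → t₂ < 2 * Real.pi →
        deriv (Fk s z k hk.1) t₁ = 0 → deriv (Fk s z k hk.1) t₂ = 0 →
        Fk s z k hk.1 t₁ ≠ Fk s z k hk.1 t₂)}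

/-- Nondegeneracy of `f` (with derivatives `f1`, `f2`), full-line version. -/
def NiceF (f f1 f2 : ℝ → ℝ) : Prop :=
  (∀ t, f1 t ≠ 0 ∨ f2 t ≠ 0) ∧
    ∀ a b, a < b → b < a + 2 * Real.pi → f1 a = 0 → f1 b = 0 → f a ≠ f b

lemma niceF_of_Ico {f f1 f2 : ℝ → ℝ} (pf : Function.Periodic f (2 * Real.pi))
    (pf1 : Function.Periodic f1 (2 * Real.pi))
    (h2 : ∀ t, f1 t ≠ 0 ∨ f2 t ≠ 0)
    (h3 : ∀ t₁ t₂ : ℝ, 0 ≤ t₁ → t₁ < t₂ → t₂ < 2 * Real.pi → f1 t₁ = 0 → f1 t₂ = 0 →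
      f t₁ ≠ f t₂) : NiceF f f1 f2 := by
  refine ⟨h2, fun a b hab hba ha hb => ?_⟩
  have hp := Real.two_pi_pos
  obtain ⟨a', ha', hfa⟩ := pf.exists_mem_Ico₀ hp a
  have red : ∀ x : ℝ, ∃ m : ℤ, 0 ≤ x - m * (2 * Real.pi) ∧ x - m * (2 * Real.pi) < 2 * Real.pi := by
    intro x
    refine ⟨⌊x / (2 * Real.pi)⌋, ?_, ?_⟩
    · have := Int.floor_le (x / (2 * Real.pi))
      rw [le_div_iff₀ hp] at this
      linarith
    · have := Int.lt_floor_add_one (x / (2 * Real.pi))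
      rw [div_lt_iff₀ hp] at this
      linarith
  obtain ⟨m, hm1, hm2⟩ := red a
  obtain ⟨l, hl1, hl2⟩ := red b
  have e1 := pf.sub_int_mul_eq (x := a) m
  have e2 := pf.sub_int_mul_eq (x := b) l
  have e3 := pf1.sub_int_mul_eq (x := a) m
  have e4 := pf1.sub_int_mul_eq (x := b) l
  rw [← e1, ← e2]
  rw [← e3] at ha
  rw [← e4] at hb
  rcases lt_trichotomy (a - m * (2 * Real.pi)) (b - l * (2 * Real.pi)) with h | h | h
  · exact h3 _ _ hm1 h hl2 ha hb
  · exfalso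
    have h' : b - a = ((l - m : ℤ) : ℝ) * (2 * Real.pi) := by push_cast; linarith
    have h5 : (0:ℝ) < ((l - m : ℤ) : ℝ) := by
      by_contra hc
      push Not at hc
      nlinarith
    have h6 : ((l - m : ℤ) : ℝ) < 1 := by
      by_contra hc
      push Not at hc
      nlinarith
    have h5' : 0 < l - m := by exact_mod_cast h5
    have h6' : l - m < 1 := by exact_mod_cast h6
    omega
  · exact (h3 _ _ hl1 h hm2 hb ha).symm

lemma isOpen_niceF {X : Type*} [TopologicalSpace X] [FirstCountableTopology X]
    (f f1 f2 : X → ℝ → ℝ)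
    (cf : Continuous (Function.uncurry f)) (cf1 : Continuous (Function.uncurry f1))
    (cf2 : Continuous (Function.uncurry f2))
    (d1 : ∀ x t, HasDerivAt (f1 x) (f2 x t) t)
    (pf : ∀ x, Function.Periodic (f x) (2 * Real.pi))
    (pf1 : ∀ x, Function.Periodic (f1 x) (2 * Real.pi))
    (pf2 : ∀ x, Function.Periodic (f2 x) (2 * Real.pi)) :
    IsOpen {x | NiceF (f x) (f1 x) (f2 x)} := by
  have hpi := Real.pi_pos
  set Φ : X → ℝ × ℝ → ℝ := fun x p => |f1 x p.1| + |∫ u in (0:ℝ)..1, f2 x (p.1 + u * p.2)|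
    + |f x (p.1 + p.2) - f x p.1| with hΦ
  have c1 : Continuous (fun q : X × ℝ × ℝ => f1 q.1 q.2.1) := cf1.comp (by fun_prop : Continuous fun q : X × ℝ × ℝ => (q.1, q.2.1))
  have c2 : Continuous (fun q : X × ℝ × ℝ => f q.1 q.2.1) := cf.comp (by fun_prop : Continuous fun q : X × ℝ × ℝ => (q.1, q.2.1))
  have c3 : Continuous (fun q : X × ℝ × ℝ => f q.1 (q.2.1 + q.2.2)) :=
    cf.comp (by fun_prop : Continuous fun q : X × ℝ × ℝ => (q.1, q.2.1 + q.2.2))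
  have c4 : Continuous (fun q : X × ℝ × ℝ => ∫ u in (0:ℝ)..1, f2 q.1 (q.2.1 + u * q.2.2)) := by
    apply intervalIntegral.continuous_parametric_intervalIntegral_of_continuous'
    exact cf2.comp (by fun_prop : Continuous fun q : (X × ℝ × ℝ) × ℝ => (q.1.1, q.1.2.1 + q.2 * q.1.2.2))
  have hc : Continuous (fun q : X × ℝ × ℝ => Φ q.1 q.2) := by
    simp only [hΦ]
    exact (c1.abs.add c4.abs).add (c3.sub c2).abs
  have key : ∀ x a h, h ≠ 0 → h * (∫ u in (0:ℝ)..1, f2 x (a + u * h)) = f1 x (a + h) - f1 x a := by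
    intro x a h hh
    have h1 := intervalIntegral.smul_integral_comp_add_mul (f2 x) h a (a := 0) (b := 1)
    have h2 := intervalIntegral.integral_eq_sub_of_hasDerivAt (a := a + h * 0) (b := a + h * 1)
      (fun t _ => d1 x t)
      ((cf2.comp (by fun_prop : Continuous fun t : ℝ => (x, t))).intervalIntegrable _ _)
    rw [h2] at h1
    simp only [smul_eq_mul, mul_zero, add_zero, mul_one] at h1
    simpa only [mul_comm] using h1
  have heq : {x | NiceF (f x) (f1 x) (f2 x)} =
      {x | ∀ p ∈ Set.Icc (0:ℝ) (2 * Real.pi) ×ˢ Set.Icc 0 Real.pi, Φ x p ≠ 0} := by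
    ext x
    simp only [Set.mem_ofPred_eq]
    constructor
    · rintro ⟨h2, h3⟩ ⟨a, h⟩ ⟨ha, hh⟩ h0
      simp only [hΦ] at h0
      simp only [Set.mem_Icc] at ha hh
      have z1 : f1 x a = 0 := by
        rw [← abs_nonpos_iff]
        linarith [abs_nonneg (∫ u in (0:ℝ)..1, f2 x (a + u * h)), abs_nonneg (f x (a + h) - f x a)]
      have z2 : (∫ u in (0:ℝ)..1, f2 x (a + u * h)) = 0 := by
        rw [← abs_nonpos_iff]
        linarith [abs_nonneg (f1 x a), abs_nonneg (f x (a + h) - f x a)]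
      have z3 : f x (a + h) - f x a = 0 := by
        rw [← abs_nonpos_iff]
        linarith [abs_nonneg (f1 x a), abs_nonneg (∫ u in (0:ℝ)..1, f2 x (a + u * h))]
      rcases hh.1.eq_or_lt with rfl | hpos
      · simp at z2
        rcases h2 a with h | h
        · exact h z1
        · exact h z2
      · have := key x a h hpos.ne'
        rw [z2, z1] at this
        refine h3 a (a + h) (by linarith) (by linarith) z1 (by linarith) (by linarith)
    · intro H
      apply niceF_of_Ico (pf x) (pf1 x)
      · intro t
        by_contra hcon
        push Not at hcon
        have hp := Real.two_pi_pos
        set m := ⌊t / (2 * Real.pi)⌋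
        have q1 : 0 ≤ t - m * (2 * Real.pi) := by
          have := Int.floor_le (t / (2 * Real.pi))
          rw [le_div_iff₀ hp] at this
          linarith
        have q2 : t - m * (2 * Real.pi) ≤ 2 * Real.pi := by
          have := Int.lt_floor_add_one (t / (2 * Real.pi))
          rw [div_lt_iff₀ hp] at this
          linarith
        refine H (t - m * (2 * Real.pi), 0) ⟨⟨q1, q2⟩, ⟨le_rfl, hpi.le⟩⟩ ?_
        simp only [hΦ, mul_zero, add_zero]
        rw [(pf1 x).sub_int_mul_eq, (pf2 x).sub_int_mul_eq]
        simp [hcon.1, hcon.2]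
      · intro a b ha hab hb za zb hf
        by_cases hd : b - a ≤ Real.pi
        · refine H (a, b - a) ⟨⟨ha, by linarith⟩, ⟨by linarith, hd⟩⟩ ?_
          have := key x a (b - a) (by linarith)
          rw [add_sub_cancel, zb, za, sub_zero] at this
          have := (mul_eq_zero.1 this).resolve_left (by linarith)
          simp only [hΦ]
          rw [this, za, add_sub_cancel, hf]
          simp
        · push Not at hd
          refine H (b, a + 2 * Real.pi - b) ⟨⟨by linarith, by linarith⟩, ⟨by linarith, by linarith⟩⟩ ?_
          have := key x b (a + 2 * Real.pi - b) (by linarith)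
          rw [add_sub_cancel, zb, pf1 x, za, sub_zero] at this
          have := (mul_eq_zero.1 this).resolve_left (by linarith)
          simp only [hΦ]
          rw [this, zb, add_sub_cancel, pf x, hf]
          simp
  rw [heq, isOpen_iff_mem_nhds]
  intro x hx
  apply (isCompact_Icc.prod isCompact_Icc).eventually_forall_of_forall_eventually
  intro p hp
  exact hc.continuousAt.eventually_ne (hx p hp)

lemma exists_niceF_perturb (f f1 f2 : ℝ → ℝ) (cf : ContDiff ℝ 1 f) (cf1 : ContDiff ℝ 1 f1)
    (cf2 : ContDiff ℝ 1 f2) {η : ℝ} (hη : 0 < η) :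
    ∃ lam mu : ℂ, ‖lam‖ < η ∧ ‖mu‖ < η ∧
      NiceF (fun t => f t + ((lam * Complex.exp (t * Complex.I)).re
          + (mu * Complex.exp (2 * t * Complex.I)).re))
        (fun t => f1 t + (-(lam * Complex.exp (t * Complex.I)).im
          - 2 * (mu * Complex.exp (2 * t * Complex.I)).im))
        (fun t => f2 t + (-(lam * Complex.exp (t * Complex.I)).re
          - 4 * (mu * Complex.exp (2 * t * Complex.I)).re)) := by
  -- assemble `(lam, mu)` from the rotated real coefficients
  let R : ℝ → ℝ → ℝ → ℝ → ℝ → ℂ × ℂ := fun m A B C D =>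
    (((A : ℂ) - B * Complex.I) * Complex.exp (-(m * Complex.I)),
      ((C : ℂ) - D * Complex.I) * Complex.exp (-(2 * m * Complex.I)))
  let Ψ : ℝ × ℝ × ℝ → ℂ × ℂ := fun p =>
    R p.1 (f2 p.1 - 4 * p.2.1) (-f1 p.1 - 2 * p.2.2) p.2.1 p.2.2
  let U : ℝ × ℝ × ℝ → ℝ := fun p => (f (p.1 + p.2.1) - f (p.1 - p.2.1)) / 2
  let V : ℝ × ℝ × ℝ → ℝ := fun p => (f1 (p.1 + p.2.1) + f1 (p.1 - p.2.1)) / 2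
  let W : ℝ × ℝ × ℝ → ℝ := fun p => (f1 (p.1 + p.2.1) - f1 (p.1 - p.2.1)) / 2
  let Θ : ℝ × ℝ × ℝ → ℂ × ℂ := fun p =>
    R p.1 (W p / Real.sin p.2.1 - 4 * p.2.2 * Real.cos p.2.1)
      ((-U p * (2 * Real.cos (2 * p.2.1)) + V p * Real.sin (2 * p.2.1)) /
        (-2 * Real.sin p.2.1 ^ 3))
      p.2.2
      ((-V p * Real.sin p.2.1 + U p * Real.cos p.2.1) / (-2 * Real.sin p.2.1 ^ 3))
  have cofR : ContDiff ℝ 1 (fun x : ℝ => (x : ℂ)) := Complex.ofRealCLM.contDiff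
  have cR : ContDiff ℝ 1 (fun p : ℝ × ℝ × ℝ × ℝ × ℝ => R p.1 p.2.1 p.2.2.1 p.2.2.2.1 p.2.2.2.2) := by
    have hh : ∀ g : ℝ × ℝ × ℝ × ℝ × ℝ → ℝ, ContDiff ℝ 1 g → ContDiff ℝ 1 (fun p => (g p : ℂ)) :=
      fun g hg => cofR.comp hg
    have h1 := hh (fun p => p.1) (by fun_prop)
    have h2 := hh (fun p => p.2.1) (by fun_prop)
    have h3 := hh (fun p => p.2.2.1) (by fun_prop)
    have h4 := hh (fun p => p.2.2.2.1) (by fun_prop)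
    have h5 := hh (fun p => p.2.2.2.2) (by fun_prop)
    simp only [R]
    fun_prop
  have cΨ : ContDiff ℝ 1 Ψ := by
    have : ContDiff ℝ 1 (fun p : ℝ × ℝ × ℝ =>
        (p.1, f2 p.1 - 4 * p.2.1, -f1 p.1 - 2 * p.2.2, p.2.1, p.2.2)) := by fun_prop
    exact cR.comp this
  let S : Set (ℝ × ℝ × ℝ) := {p | 0 < p.2.1 ∧ p.2.1 < Real.pi}
  have hS : Convex ℝ S := by
    rintro ⟨a, b, c⟩ ⟨h1, h2⟩ ⟨a', b', c'⟩ ⟨h1', h2'⟩ u v hu hv huv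
    have := (convex_Ioo (𝕜 := ℝ) 0 Real.pi) ⟨h1, h2⟩ ⟨h1', h2'⟩ hu hv huv
    exact this
  have cΘ : ContDiffOn ℝ 1 Θ S := by
    have hne : ∀ p ∈ S, Real.sin p.2.1 ≠ 0 := fun p hp => (Real.sin_pos_of_pos_of_lt_pi hp.1 hp.2).ne'
    have hne3 : ∀ p ∈ S, -2 * Real.sin p.2.1 ^ 3 ≠ 0 := fun p hp =>
      mul_ne_zero (by norm_num) (pow_ne_zero _ (hne p hp))
    have cU : ContDiff ℝ 1 U := by simp only [U]; fun_prop
    have cV : ContDiff ℝ 1 V := by simp only [V]; fun_prop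
    have cW : ContDiff ℝ 1 W := by simp only [W]; fun_prop
    have : ContDiffOn ℝ 1 (fun p : ℝ × ℝ × ℝ =>
        (p.1, W p / Real.sin p.2.1 - 4 * p.2.2 * Real.cos p.2.1,
          (-U p * (2 * Real.cos (2 * p.2.1)) + V p * Real.sin (2 * p.2.1)) /
        (-2 * Real.sin p.2.1 ^ 3), p.2.2,
        (-V p * Real.sin p.2.1 + U p * Real.cos p.2.1) / (-2 * Real.sin p.2.1 ^ 3))) S := by
      refine ContDiffOn.prodMk (by fun_prop) (ContDiffOn.prodMk ?_ (ContDiffOn.prodMk ?_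
        (ContDiffOn.prodMk (by fun_prop) ?_)))
      · exact ((by fun_prop : ContDiffOn ℝ 1 W S).div (by fun_prop) hne).sub (by fun_prop)
      · exact ContDiffOn.div (by fun_prop) (by fun_prop) hne3
      · exact ContDiffOn.div (by fun_prop) (by fun_prop) hne3
    exact cR.comp_contDiffOn this
  have hdim : dimH (Set.range Ψ ∪ Θ '' S) < Module.finrank ℝ (ℂ × ℂ) := by
    rw [dimH_union]
    have e4 : Module.finrank ℝ (ℂ × ℂ) = 4 := by simp
    have e3 : Module.finrank ℝ (ℝ × ℝ × ℝ) = 3 := by simp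
    have a1 := cΨ.dimH_range_le
    have a2 := (cΘ.dimH_image_le hS subset_rfl).trans (dimH_mono (Set.subset_univ S))
    rw [Real.dimH_univ_eq_finrank] at a2
    rw [e3] at a1 a2
    rw [e4]
    refine (max_le a1 a2).trans_lt ?_
    norm_num
  obtain ⟨⟨lam, mu⟩, hnot, hdist⟩ := (dense_compl_of_dimH_lt_finrank hdim).exists_dist_lt 0 hη
  |> fun ⟨y, hy, hd⟩ => (⟨y, hy, hd⟩ : ∃ y : ℂ × ℂ, y ∈ (Set.range Ψ ∪ Θ '' S)ᶜ ∧ dist 0 y < η)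
  rw [dist_comm, dist_zero_right, Prod.norm_def] at hdist
  have rot : ∀ m A B C D : ℝ, (lam * Complex.exp (m * Complex.I)) = (A : ℂ) - B * Complex.I →
      (mu * Complex.exp (2 * m * Complex.I)) = (C : ℂ) - D * Complex.I →
      (lam, mu) = R m A B C D := by
    intro m A B C D h1 h2
    simp only [R]
    rw [← h1, ← h2, mul_assoc, mul_assoc, ← Complex.exp_add, ← Complex.exp_add]
    simp
  have split : ∀ z : ℂ, z = ((z.re : ℝ) : ℂ) - ((-z.im : ℝ) : ℂ) * Complex.I := by
    intro z
    apply Complex.ext <;> simp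
  have rr : ∀ (z : ℂ) (m h : ℝ), z * Complex.exp (((m + h : ℝ) : ℂ) * Complex.I) =
      (z * Complex.exp (m * Complex.I)) * (Real.cos h + Real.sin h * Complex.I) := by
    intro z m h
    push_cast
    rw [← Complex.exp_mul_I, add_mul, Complex.exp_add]
    ring
  have rr2 : ∀ (z : ℂ) (m h : ℝ), z * Complex.exp (2 * ((m + h : ℝ) : ℂ) * Complex.I) =
      (z * Complex.exp (2 * m * Complex.I)) *
        (Real.cos (2 * h) + Real.sin (2 * h) * Complex.I) := by
    intro z m h
    push_cast
    rw [← Complex.exp_mul_I, mul_add, add_mul, Complex.exp_add]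
    ring
  refine ⟨lam, mu, (le_max_left _ _).trans_lt hdist, (le_max_right _ _).trans_lt hdist, ?_, ?_⟩
  · intro t
    by_contra hcon
    push Not at hcon
    obtain ⟨h1, h2⟩ := hcon
    apply hnot
    left
    set P := lam * Complex.exp (t * Complex.I) with hP
    set Q := mu * Complex.exp (2 * t * Complex.I) with hQ
    refine ⟨(t, Q.re, -Q.im), ?_⟩
    refine (rot _ _ _ _ _ ?_ ?_).symm
    · rw [← hP]
      nth_rewrite 1 [split P]
      congr 3 <;> linarith
    · rw [← hQ]
      exact split Q
  · intro a b hab hba h1 h2 h3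
    apply hnot
    right
    set m := (a + b) / 2 with hm
    set h := (b - a) / 2 with hh
    have ea : a = m + -h := by simp only [hm, hh]; ring
    have eb : b = m + h := by simp only [hm, hh]; ring
    have hmS : 0 < h ∧ h < Real.pi := ⟨by simp only [hh]; linarith, by simp only [hh]; linarith⟩
    have hsin := Real.sin_pos_of_pos_of_lt_pi hmS.1 hmS.2
    clear_value m h
    subst ea eb
    simp only [rr, rr2] at h1 h2 h3
    set P := lam * Complex.exp (m * Complex.I) with hP
    set Q := mu * Complex.exp (2 * m * Complex.I) with hQ
    simp only [Complex.mul_re, Complex.mul_im, Complex.add_re, Complex.add_im, Complex.ofReal_re,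
      Complex.ofReal_im, Complex.I_re, Complex.I_im, Real.cos_neg, Real.sin_neg, mul_neg,
      Complex.neg_re, Complex.neg_im, Complex.ofReal_neg] at h1 h2 h3
    have s2 := Real.sin_two_mul h
    have c2 := Real.cos_two_mul h
    have sc := Real.sin_sq_add_cos_sq h
    rw [s2, c2] at h1 h2 h3
    have E1 : -P.im * Real.sin h + -Q.im * (2 * Real.sin h * Real.cos h) =
        -((f (m + h) - f (m + -h)) / 2) := by linear_combination -h3 / 2
    have E2 : -P.im * Real.cos h + 2 * -Q.im * (2 * Real.cos h ^ 2 - 1) =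
        -((f1 (m + h) + f1 (m + -h)) / 2) := by linear_combination (h1 + h2) / 2
    have hs3 : -2 * Real.sin h ^ 3 ≠ 0 := mul_ne_zero (by norm_num) (pow_ne_zero _ hsin.ne')
    refine ⟨(m, h, Q.re), hmS, ?_⟩
    refine (rot _ _ _ _ _ ?_ ?_).symm
    · rw [← hP]
      nth_rewrite 1 [split P]
      simp only [U, V, W, sub_eq_add_neg m h]
      rw [s2, c2]
      congr 3
      · rw [eq_sub_iff_add_eq, eq_div_iff hsin.ne']
        linear_combination (h1 - h2) / 2
      · rw [eq_div_iff hs3]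
        linear_combination E1 * 2 * (2 * Real.cos h ^ 2 - 1) - E2 * (2 * Real.sin h * Real.cos h)
          + 2 * P.im * Real.sin h * sc
    · rw [← hQ]
      nth_rewrite 1 [split Q]
      simp only [U, V, sub_eq_add_neg m h]
      congr 3
      rw [eq_div_iff hs3]
      linear_combination E2 * Real.sin h - E1 * Real.cos h
          + 2 * Q.im * Real.sin h * sc

/-- The `m`-th derivative series. -/
noncomputable def Ser (m : ℕ) (σ : ℝ) (w : ℕ → ℂ) (t : ℝ) : ℂ :=
  ∑' j : ℕ, w j * ((Complex.I * ((j : ℂ) + 1)) ^ m *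
    Complex.exp (((j : ℂ) + 1) * (-(σ : ℂ) + Complex.I * (t : ℂ))))

/-- Majorant of the derivative series. -/
noncomputable def serBd (m : ℕ) (σ : ℝ) (j : ℕ) : ℝ :=
  ((j : ℝ) + 1) ^ m * Real.exp (-σ * ((j : ℝ) + 1))

lemma serBd_nonneg (m : ℕ) (σ : ℝ) (j : ℕ) : 0 ≤ serBd m σ j := by
  unfold serBd; positivity

lemma summable_serBd (m : ℕ) {σ : ℝ} (hσ : 0 < σ) : Summable (serBd m σ) := by
  have := (summable_nat_add_iff 1).2 (Real.summable_pow_mul_exp_neg_nat_mul m hσ)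
  refine this.congr fun j => ?_
  simp [serBd]

lemma norm_ser_factor (m : ℕ) (σ : ℝ) (j : ℕ) (t : ℝ) :
    ‖(Complex.I * ((j : ℂ) + 1)) ^ m *
      Complex.exp (((j : ℂ) + 1) * (-(σ : ℂ) + Complex.I * (t : ℂ)))‖ = serBd m σ j := by
  have h : ‖(j : ℂ) + 1‖ = (j : ℝ) + 1 := by
    have : ((j : ℂ) + 1) = ((j + 1 : ℕ) : ℂ) := by push_cast; rfl
    rw [this, Complex.norm_natCast]; push_cast; rfl
  rw [norm_mul, norm_pow, norm_mul, Complex.norm_I, one_mul, h, Complex.norm_exp, serBd]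
  congr 2
  simp
  ring

lemma norm_ser_term_le (m : ℕ) (σ : ℝ) {w : ℕ → ℂ} {C : ℝ} (hw : ∀ j, ‖w j‖ ≤ C) (j : ℕ) (t : ℝ) :
    ‖w j * ((Complex.I * ((j : ℂ) + 1)) ^ m *
      Complex.exp (((j : ℂ) + 1) * (-(σ : ℂ) + Complex.I * (t : ℂ))))‖ ≤ C * serBd m σ j := by
  rw [norm_mul, norm_ser_factor]
  exact mul_le_mul_of_nonneg_right (hw j) (serBd_nonneg _ _ _)

lemma summable_ser (m : ℕ) {σ : ℝ} (hσ : 0 < σ) {w : ℕ → ℂ} {C : ℝ} (hw : ∀ j, ‖w j‖ ≤ C) (t : ℝ) :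
    Summable (fun j : ℕ => w j * ((Complex.I * ((j : ℂ) + 1)) ^ m *
      Complex.exp (((j : ℂ) + 1) * (-(σ : ℂ) + Complex.I * (t : ℂ))))) :=
  Summable.of_norm_bounded ((summable_serBd m hσ).mul_left C)
    (fun j => norm_ser_term_le m σ hw j t)

lemma norm_ser_le (m : ℕ) {σ : ℝ} (hσ : 0 < σ) {w : ℕ → ℂ} {C : ℝ} (hw : ∀ j, ‖w j‖ ≤ C) (t : ℝ) :
    ‖Ser m σ w t‖ ≤ C * ∑' j, serBd m σ j := by
  rw [← tsum_mul_left]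
  exact tsum_of_norm_bounded ((summable_serBd m hσ).mul_left C).hasSum
    (fun j => norm_ser_term_le m σ hw j t)

lemma ser_add (m : ℕ) {σ : ℝ} (hσ : 0 < σ) {w w' : ℕ → ℂ} {C C' : ℝ} (hw : ∀ j, ‖w j‖ ≤ C)
    (hw' : ∀ j, ‖w' j‖ ≤ C') (t : ℝ) :
    Ser m σ (fun j => w j + w' j) t = Ser m σ w t + Ser m σ w' t := by
  unfold Ser
  rw [← (summable_ser m hσ hw t).tsum_add (summable_ser m hσ hw' t)]
  congr 1; ext j; ring

lemma ser_sub (m : ℕ) {σ : ℝ} (hσ : 0 < σ) {w w' : ℕ → ℂ} {C C' : ℝ} (hw : ∀ j, ‖w j‖ ≤ C)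
    (hw' : ∀ j, ‖w' j‖ ≤ C') (t : ℝ) :
    Ser m σ (fun j => w j - w' j) t = Ser m σ w t - Ser m σ w' t := by
  unfold Ser
  rw [← (summable_ser m hσ hw t).tsum_sub (summable_ser m hσ hw' t)]
  congr 1; ext j; ring

lemma hasDerivAt_ser (m : ℕ) {σ : ℝ} (hσ : 0 < σ) {w : ℕ → ℂ} {C : ℝ} (hw : ∀ j, ‖w j‖ ≤ C)
    (t : ℝ) : HasDerivAt (Ser m σ w) (Ser (m + 1) σ w t) t := by
  unfold Ser
  refine hasDerivAt_tsum (𝕜 := ℝ) (y₀ := (0 : ℝ)) (u := fun j => C * serBd (m + 1) σ j)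
    (g := fun (j : ℕ) (y : ℝ) => w j * ((Complex.I * ((j : ℂ) + 1)) ^ m *
      Complex.exp (((j : ℂ) + 1) * (-(σ : ℂ) + Complex.I * (y : ℂ)))))
    (g' := fun (j : ℕ) (y : ℝ) => w j * ((Complex.I * ((j : ℂ) + 1)) ^ (m + 1) *
      Complex.exp (((j : ℂ) + 1) * (-(σ : ℂ) + Complex.I * (y : ℂ)))))
    ((summable_serBd (m + 1) hσ).mul_left C) ?_
    (fun j y => norm_ser_term_le (m + 1) σ hw j y) (summable_ser m hσ hw 0) t
  intro j y
  have h1 : HasDerivAt (fun y : ℝ => (y : ℂ)) 1 y := Complex.ofRealCLM.hasDerivAt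
  have h2 := ((((h1.const_mul Complex.I).const_add (-(σ : ℂ))).const_mul
    ((j : ℂ) + 1)).cexp.const_mul ((Complex.I * ((j : ℂ) + 1)) ^ m)).const_mul (w j)
  refine h2.congr_deriv ?_
  rw [pow_succ]
  ring

lemma ser_periodic (m : ℕ) (σ : ℝ) (w : ℕ → ℂ) : Function.Periodic (Ser m σ w) (2 * Real.pi) := by
  intro t
  unfold Ser
  congr 1; ext j
  congr 2
  rw [Complex.exp_eq_exp_iff_exists_int]
  refine ⟨(j : ℤ) + 1, ?_⟩
  push_cast
  ring

/-- Real version. -/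
noncomputable def Fr (m : ℕ) (σ : ℝ) (w : ℕ → ℂ) (t : ℝ) : ℝ := 2 * (Ser m σ w t).re

lemma hasDerivAt_Fr (m : ℕ) {σ : ℝ} (hσ : 0 < σ) {w : ℕ → ℂ} {C : ℝ} (hw : ∀ j, ‖w j‖ ≤ C)
    (t : ℝ) : HasDerivAt (Fr m σ w) (Fr (m + 1) σ w t) t := by
  have h1 : HasDerivAt (fun t => (Ser m σ w t).re) (Ser (m + 1) σ w t).re t :=
    Complex.reCLM.hasFDerivAt.comp_hasDerivAt t (hasDerivAt_ser m hσ hw t)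
  exact h1.const_mul (2 : ℝ)

lemma continuous_Fr (m : ℕ) {σ : ℝ} (hσ : 0 < σ) {w : ℕ → ℂ} {C : ℝ} (hw : ∀ j, ‖w j‖ ≤ C) :
    Continuous (Fr m σ w) :=
  continuous_iff_continuousAt.2 fun t => (hasDerivAt_Fr m hσ hw t).continuousAt

lemma deriv_Fr (m : ℕ) {σ : ℝ} (hσ : 0 < σ) {w : ℕ → ℂ} {C : ℝ} (hw : ∀ j, ‖w j‖ ≤ C) :
    deriv (Fr m σ w) = Fr (m + 1) σ w := funext fun t => (hasDerivAt_Fr m hσ hw t).deriv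

lemma contDiff_Fr (m : ℕ) {σ : ℝ} (hσ : 0 < σ) {w : ℕ → ℂ} {C : ℝ} (hw : ∀ j, ‖w j‖ ≤ C) :
    ContDiff ℝ 1 (Fr m σ w) := by
  rw [contDiff_one_iff_deriv]
  refine ⟨fun t => (hasDerivAt_Fr m hσ hw t).differentiableAt, ?_⟩
  rw [deriv_Fr m hσ hw]
  exact continuous_Fr (m + 1) hσ hw

lemma Fr_periodic (m : ℕ) (σ : ℝ) (w : ℕ → ℂ) : Function.Periodic (Fr m σ w) (2 * Real.pi) := by
  intro t
  simp only [Fr]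
  rw [ser_periodic m σ w t]

/-- The coefficients of `z` along the ray of `k`. -/
noncomputable def seqOf {n : ℕ} (z : XSp n) (k : Fin n → ℤ) (hk : ZSharp k) (j : ℕ) : ℂ :=
  (z : ∀ _ : {k : Fin n → ℤ // ZSharp k}, ℂ) ⟨((j : ℤ) + 1) • k, zsharp_smul hk j⟩

lemma norm_seqOf_le {n : ℕ} (z : XSp n) (k : Fin n → ℤ) (hk : ZSharp k) (j : ℕ) :
    ‖seqOf z k hk j‖ ≤ ‖z‖ := lp.norm_apply_le_norm (by simp) z _

lemma Fk_eq {n : ℕ} (s : ℝ) (z : XSp n) (k : Fin n → ℤ) (hk : ZSharp k) :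
    Fk s z k hk = Fr 0 ((onormZ k : ℝ) * s) (seqOf z k hk) := by
  ext t
  simp only [Fk, Fr, Ser, seqOf]
  congr 2
  congr 1
  ext j
  push_cast
  rw [pow_zero, one_mul, neg_mul]

lemma onormZ_pos {n : ℕ} {k : Fin n → ℤ} (hk : ZSharp k) : 0 < onormZ k := by
  obtain ⟨j, hj, _⟩ := hk
  unfold onormZ
  exact lt_of_lt_of_le (abs_pos.2 hj.ne')
    (Finset.single_le_sum (f := fun i => |k i|) (fun i _ => abs_nonneg _) (Finset.mem_univ j))

/-- Goodness of `z` along `k`. -/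
def GoodK {n : ℕ} (s : ℝ) (z : XSp n) (k : Fin n → ℤ) (hk : ZSharp k) : Prop :=
  NiceF (Fr 0 ((onormZ k : ℝ) * s) (seqOf z k hk)) (Fr 1 ((onormZ k : ℝ) * s) (seqOf z k hk))
    (Fr 2 ((onormZ k : ℝ) * s) (seqOf z k hk))

lemma goodK_iff {n : ℕ} {s : ℝ} (hs : 0 < s) (z : XSp n) (k : Fin n → ℤ) (hk : ZSharp k) :
    GoodK s z k hk ↔ (∀ t : ℝ, 0 < |deriv (Fk s z k hk) t| + |deriv (deriv (Fk s z k hk)) t|) ∧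
      (∀ t₁ t₂ : ℝ, 0 ≤ t₁ → t₁ < t₂ → t₂ < 2 * Real.pi →
        deriv (Fk s z k hk) t₁ = 0 → deriv (Fk s z k hk) t₂ = 0 →
        Fk s z k hk t₁ ≠ Fk s z k hk t₂) := by
  have hσ : 0 < (onormZ k : ℝ) * s := mul_pos (by exact_mod_cast onormZ_pos hk) hs
  have hw := norm_seqOf_le z k hk
  rw [Fk_eq, deriv_Fr 0 hσ hw, deriv_Fr (0 + 1) hσ hw]
  simp only [zero_add, Nat.reduceAdd]
  have h2 : ∀ x y : ℝ, 0 < |x| + |y| ↔ x ≠ 0 ∨ y ≠ 0 := by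
    intro x y
    constructor
    · intro h
      by_contra hc
      push Not at hc
      simp [hc.1, hc.2] at h
    · rintro (h | h)
      · have := abs_pos.2 h; positivity
      · have := abs_pos.2 h; positivity
  simp only [h2]
  constructor
  · rintro ⟨a, b⟩
    exact ⟨a, fun t₁ t₂ h0 h12 h3 => b t₁ t₂ h12 (by linarith)⟩
  · rintro ⟨a, b⟩
    exact niceF_of_Ico (Fr_periodic _ _ _) (Fr_periodic _ _ _) a b

lemma continuous_Fr_joint {n : ℕ} (m : ℕ) {s : ℝ} (hs : 0 < s) (k : Fin n → ℤ) (hk : ZSharp k) :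
    Continuous (Function.uncurry
      (fun z : XSp n => Fr m ((onormZ k : ℝ) * s) (seqOf z k hk))) := by
  have hσ : 0 < (onormZ k : ℝ) * s := mul_pos (by exact_mod_cast onormZ_pos hk) hs
  set σ := (onormZ k : ℝ) * s
  have hB : 0 ≤ 2 * ∑' j, serBd m σ j := mul_nonneg zero_le_two (tsum_nonneg (serBd_nonneg m σ))
  refine continuous_prod_of_continuous_lipschitzWith _ (Real.toNNReal (2 * ∑' j, serBd m σ j)) ?_ ?_
  · intro z
    exact continuous_Fr m hσ (norm_seqOf_le z k hk)
  · intro t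
    refine LipschitzWith.of_dist_le_mul fun z z' => ?_
    rw [Real.coe_toNNReal _ hB, Real.dist_eq, dist_eq_norm]
    simp only [Function.uncurry, Fr]
    rw [← mul_sub, ← Complex.sub_re, ← ser_sub m hσ (norm_seqOf_le z k hk) (norm_seqOf_le z' k hk),
      abs_mul, abs_two]
    have := norm_ser_le m hσ (w := fun j => seqOf z k hk j - seqOf z' k hk j)
      (fun j => norm_seqOf_le (z - z') k hk j) t
    have h2 := (Complex.abs_re_le_norm _).trans this
    linarith

lemma isOpen_goodK {n : ℕ} {s : ℝ} (hs : 0 < s) (k : Fin n → ℤ) (hk : ZSharp k) :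
    IsOpen {z : XSp n | GoodK s z k hk} := by
  have hσ : 0 < (onormZ k : ℝ) * s := mul_pos (by exact_mod_cast onormZ_pos hk) hs
  exact isOpen_niceF _ _ _ (continuous_Fr_joint 0 hs k hk) (continuous_Fr_joint 1 hs k hk)
    (continuous_Fr_joint 2 hs k hk) (fun z t => hasDerivAt_Fr 1 hσ (norm_seqOf_le z k hk) t)
    (fun _ => Fr_periodic _ _ _) (fun _ => Fr_periodic _ _ _) (fun _ => Fr_periodic _ _ _)

lemma finite_onorm_le (n : ℕ) (K : ℝ) : {k : Fin n → ℤ | (onormZ k : ℝ) ≤ K}.Finite := by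
  apply (Set.Finite.pi' (fun _ : Fin n => Set.finite_Icc (-⌊K⌋) ⌊K⌋)).subset
  intro k hk i
  have h1 : onormZ k ≤ ⌊K⌋ := Int.le_floor.2 hk
  have h2 : |k i| ≤ onormZ k :=
    Finset.single_le_sum (f := fun i => |k i|) (fun i _ => abs_nonneg _) (Finset.mem_univ i)
  exact abs_le.1 (h2.trans h1)

lemma Ks_anti {c s : ℝ} (hs : 0 < s) (hc : 1 ≤ c) {δ δ' : ℝ} (h' : 0 < δ') (h : δ' ≤ δ) :
    Ks c s δ ≤ Ks c s δ' := by
  unfold Ks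
  have : 0 < s * δ' := by positivity
  have : 0 < δ := by linarith
  gcongr

lemma Ks_cont {c s : ℝ} (hs : 0 < s) {δ : ℝ} (h : 0 < δ) : ContinuousAt (Ks c s) δ := by
  unfold Ks
  have h1 : s * δ ≠ 0 := by positivity
  have h2 : 1 / (s * δ) ≠ 0 := by positivity
  have h3 : ContinuousAt (fun δ => Real.log (1 / (s * δ))) δ :=
    (ContinuousAt.div (by fun_prop) (by fun_prop) h1).log h2
  exact continuousAt_const.mul (continuousAt_const.max (continuousAt_const.max
    (continuousAt_const.mul h3)))

lemma Pprime_iff {n : ℕ} {c s : ℝ} (hs : 0 < s) (z : XSp n) : z ∈ Pprime n c s ↔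
    ∃ δ : ℝ, 0 < δ ∧ δ ≤ 1 ∧
    (∀ (k : Fin n → ℤ) (hk : ZStar k), Ks c s δ < (onormZ k : ℝ) →
      δ ≤ ‖(z : ∀ _ : {k : Fin n → ℤ // ZSharp k}, ℂ) ⟨k, hk.1⟩‖) ∧
    (∀ (k : Fin n → ℤ) (hk : ZStar k), (onormZ k : ℝ) ≤ Ks c s δ → GoodK s z k hk.1) := by
  unfold Pprime
  simp only [goodK_iff hs]
  constructor
  · rintro ⟨δ, a, b, c, d, e⟩
    exact ⟨δ, a, b, c, fun k hk h => ⟨d k hk h, e k hk h⟩⟩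
  · rintro ⟨δ, a, b, c, d⟩
    exact ⟨δ, a, b, c, fun k hk h => (d k hk h).1, fun k hk h => (d k hk h).2⟩

lemma isOpen_Pprime (n : ℕ) {c s : ℝ} (hs : 0 < s) (hc : 1 ≤ c) : IsOpen (Pprime n c s) := by
  rw [isOpen_iff_mem_nhds]
  intro z hz
  obtain ⟨δ, h0, h1, hP1, hP2⟩ := (Pprime_iff hs z).1 hz
  have hev : ∀ᶠ δ' in nhds δ, Ks c s δ' < ⌊Ks c s δ⌋ + 1 ∧ 0 < δ' :=
    ((Ks_cont hs h0).eventually_lt_const (Int.lt_floor_add_one _)).and (lt_mem_nhds h0)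
  obtain ⟨δ', ⟨hK, h0'⟩, hlt⟩ := ((hev.filter_mono nhdsWithin_le_nhds).and
    (self_mem_nhdsWithin : Set.Iio δ ∈ nhdsWithin δ (Set.Iio δ))).exists
  have hlt : δ' < δ := hlt
  have hKint : ∀ m : ℤ, (m : ℝ) ≤ Ks c s δ' → (m : ℝ) ≤ Ks c s δ := by
    intro m hm
    have : (m : ℝ) < ((⌊Ks c s δ⌋ + 1 : ℤ) : ℝ) := by push_cast; linarith
    have : m < ⌊Ks c s δ⌋ + 1 := by exact_mod_cast this
    exact Int.le_floor.1 (by omega)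
  have e1 : ∀ᶠ z' in nhds z, ∀ k ∈ {k : Fin n → ℤ | (onormZ k : ℝ) ≤ Ks c s δ},
      ∀ hk : ZStar k, GoodK s z' k hk.1 := by
    rw [Filter.eventually_all_finite (finite_onorm_le n _)]
    intro k hkK
    by_cases hk : ZStar k
    · filter_upwards [(isOpen_goodK hs k hk.1).mem_nhds (hP2 k hk hkK)] with z' hz' _
      exact hz'
    · exact Filter.Eventually.of_forall fun _ h => absurd h hk
  filter_upwards [e1, Metric.ball_mem_nhds z (sub_pos.2 hlt)] with z' hz' hball
  refine (Pprime_iff hs z').2 ⟨δ', h0', by linarith, ?_, ?_⟩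
  · intro k hk hkK
    have a1 := hP1 k hk ((Ks_anti hs hc h0' hlt.le).trans_lt hkK)
    have a2 : ‖(z' - z : XSp n) ⟨k, hk.1⟩‖ ≤ ‖z' - z‖ := lp.norm_apply_le_norm (by simp) _ _
    rw [Metric.mem_ball, dist_eq_norm] at hball
    rw [lp.coeFn_sub, Pi.sub_apply] at a2
    have a3 := norm_sub_norm_le (z ⟨k, hk.1⟩) (z' ⟨k, hk.1⟩)
    rw [norm_sub_rev] at a3
    linarith
  · intro k hk hkK
    exact hz' k (hKint _ hkK) hk

/-- Perturbation of the first two coefficients. -/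
def pertSeq (l₀ l₁ : ℂ) (j : ℕ) : ℂ := if j = 0 then l₀ else if j = 1 then l₁ else 0

lemma ser_pertSeq (m : ℕ) (σ : ℝ) (l₀ l₁ : ℂ) (t : ℝ) : Ser m σ (pertSeq l₀ l₁) t =
    Complex.I ^ m * (l₀ * Real.exp (-σ) * Complex.exp (t * Complex.I)) +
      (2 * Complex.I) ^ m * (l₁ * Real.exp (-(2 * σ)) * Complex.exp (2 * t * Complex.I)) := by
  unfold Ser
  rw [tsum_eq_sum (s := Finset.range 2)]
  · rw [Finset.sum_range_succ, Finset.sum_range_one]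
    have e1 : Complex.exp (-(σ : ℂ) + Complex.I * t) =
        Complex.exp (-(σ : ℂ)) * Complex.exp (t * Complex.I) := by
      rw [← Complex.exp_add]; ring_nf
    have e2 : Complex.exp (2 * (-(σ : ℂ) + Complex.I * t)) =
        Complex.exp (-(2 * (σ : ℂ))) * Complex.exp (2 * t * Complex.I) := by
      rw [← Complex.exp_add]; ring_nf
    have e3 : (1 : ℂ) + 1 = 2 := by norm_num
    simp only [pertSeq, if_true, one_ne_zero, if_false, Nat.cast_zero, Nat.cast_one, zero_add,
      mul_one, one_mul, e3, e1, e2]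
    push_cast
    ring
  · intro j hj
    simp only [Finset.mem_range] at hj
    have h0 : j ≠ 0 := by omega
    have h1 : j ≠ 1 := by omega
    simp [pertSeq, h0, h1]

lemma exists_pert {σ : ℝ} (hσ : 0 < σ) {w : ℕ → ℂ} {C : ℝ} (hw : ∀ j, ‖w j‖ ≤ C) {ε : ℝ}
    (hε : 0 < ε) : ∃ l₀ l₁ : ℂ, ‖l₀‖ ≤ ε ∧ ‖l₁‖ ≤ ε ∧
      NiceF (Fr 0 σ (fun j => w j + pertSeq l₀ l₁ j)) (Fr 1 σ (fun j => w j + pertSeq l₀ l₁ j))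
        (Fr 2 σ (fun j => w j + pertSeq l₀ l₁ j)) := by
  have hη : 0 < ε * Real.exp (-(2 * σ)) := by positivity
  obtain ⟨lam, mu, hl, hm, hN⟩ := exists_niceF_perturb _ _ _ (contDiff_Fr 0 hσ hw)
    (contDiff_Fr 1 hσ hw) (contDiff_Fr 2 hσ hw) hη
  have hn1 : ‖lam / 2 * (Real.exp σ : ℂ)‖ ≤ ε := by
    rw [norm_mul, norm_div, Complex.norm_real, Real.norm_of_nonneg (Real.exp_pos _).le]
    have h1 : ‖lam‖ * Real.exp σ ≤ ε * Real.exp (-(2 * σ)) * Real.exp σ := by gcongr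
    have h2 : Real.exp (-(2 * σ)) * Real.exp σ ≤ 1 := by
      rw [← Real.exp_add]; exact Real.exp_le_one_iff.2 (by linarith)
    have h3 : 0 ≤ ‖lam‖ * Real.exp σ := by positivity
    have h4 : ‖(2 : ℂ)‖ = 2 := by simp
    rw [h4]
    nlinarith
  have hn2 : ‖mu / 2 * (Real.exp (2 * σ) : ℂ)‖ ≤ ε := by
    rw [norm_mul, norm_div, Complex.norm_real, Real.norm_of_nonneg (Real.exp_pos _).le]
    have h1 : ‖mu‖ * Real.exp (2 * σ) ≤ ε * Real.exp (-(2 * σ)) * Real.exp (2 * σ) := by gcongr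
    have h2 : Real.exp (-(2 * σ)) * Real.exp (2 * σ) = 1 := by
      rw [← Real.exp_add]; simp
    have h3 : 0 ≤ ‖mu‖ * Real.exp (2 * σ) := by positivity
    have h4 : ‖(2 : ℂ)‖ = 2 := by simp
    rw [h4]
    rw [mul_assoc, h2] at h1
    linarith
  refine ⟨lam / 2 * (Real.exp σ : ℂ), mu / 2 * (Real.exp (2 * σ) : ℂ), hn1, hn2, ?_⟩
  set l₀ := lam / 2 * (Real.exp σ : ℂ) with hl₀
  set l₁ := mu / 2 * (Real.exp (2 * σ) : ℂ) with hl₁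
  have hp : ∀ j, ‖pertSeq l₀ l₁ j‖ ≤ ε := by
    intro j
    unfold pertSeq
    split_ifs
    · exact hn1
    · exact hn2
    · simpa using hε.le
  have i0 : l₀ * (Real.exp (-σ) : ℝ) = lam / 2 := by
    rw [hl₀, mul_assoc, ← Complex.ofReal_mul, ← Real.exp_add]; simp
  have i1 : l₁ * (Real.exp (-(2 * σ)) : ℝ) = mu / 2 := by
    rw [hl₁, mul_assoc, ← Complex.ofReal_mul, ← Real.exp_add]; simp
  have hF : ∀ m t, Fr m σ (fun j => w j + pertSeq l₀ l₁ j) t = Fr m σ w t +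
      (Complex.I ^ m * (lam * Complex.exp (t * Complex.I)) +
      (2 * Complex.I) ^ m * (mu * Complex.exp (2 * t * Complex.I))).re := by
    intro m t
    simp only [Fr]
    rw [ser_add m hσ hw hp, ser_pertSeq, i0, i1, Complex.add_re, mul_add]
    congr 1
    have : Complex.I ^ m * (lam / 2 * Complex.exp (t * Complex.I)) +
      (2 * Complex.I) ^ m * (mu / 2 * Complex.exp (2 * t * Complex.I)) =
      ((1 / 2 : ℝ) : ℂ) * (Complex.I ^ m * (lam * Complex.exp (t * Complex.I)) +
      (2 * Complex.I) ^ m * (mu * Complex.exp (2 * t * Complex.I))) := by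
      push_cast; ring
    rw [this, Complex.re_ofReal_mul]
    ring
  convert hN using 1
  · ext t; rw [hF]; simp
  · ext t; rw [hF]
    have : (Complex.I ^ 1 * (lam * Complex.exp (t * Complex.I)) +
      (2 * Complex.I) ^ 1 * (mu * Complex.exp (2 * t * Complex.I))) =
      Complex.I * (lam * Complex.exp (t * Complex.I)) +
      ((2 : ℝ) : ℂ) * (Complex.I * (mu * Complex.exp (2 * t * Complex.I))) := by push_cast; ring
    rw [this, Complex.add_re, Complex.re_ofReal_mul, Complex.I_mul_re, Complex.I_mul_re]
    ring
  · ext t; rw [hF]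
    have : (Complex.I ^ 2 * (lam * Complex.exp (t * Complex.I)) +
      (2 * Complex.I) ^ 2 * (mu * Complex.exp (2 * t * Complex.I))) =
      -(lam * Complex.exp (t * Complex.I)) +
      ((-4 : ℝ) : ℂ) * (mu * Complex.exp (2 * t * Complex.I)) := by
      rw [mul_pow, Complex.I_sq]; push_cast; ring
    rw [this, Complex.add_re, Complex.re_ofReal_mul, Complex.neg_re]
    ring

lemma gcd_smul_star {n : ℕ} {k : Fin n → ℤ} (hk : ZStar k) (j : ℕ) :
    Finset.univ.gcd (((j : ℤ) + 1) • k) = (j : ℤ) + 1 := by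
  have h : (((j : ℤ) + 1) • k) = fun i => ((j : ℤ) + 1) * k i := by ext i; simp
  rw [h, Finset.gcd_mul_left, hk.2, mul_one, Int.normalize_of_nonneg (by positivity)]

open Classical in
/-- The perturbation on the whole lattice. -/
noncomputable def pertAll {n : ℕ} (L0 L1 : (Fin n → ℤ) → ℂ) (q : Fin n → ℤ) : ℂ :=
  if ZStar q then L0 q else
    if h : ∃ k, ZStar k ∧ q = (2 : ℤ) • k then L1 h.choose else 0

lemma pertAll_ray {n : ℕ} (L0 L1 : (Fin n → ℤ) → ℂ) {k : Fin n → ℤ} (hk : ZStar k) (j : ℕ) :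
    pertAll L0 L1 (((j : ℤ) + 1) • k) = pertSeq (L0 k) (L1 k) j := by
  have hg := gcd_smul_star hk j
  unfold pertAll pertSeq
  rcases Nat.lt_trichotomy j 1 with h | h | h
  · have : j = 0 := by omega
    subst this
    simp [hk]
  · subst h
    have hns : ¬ ZStar ((((1 : ℕ) : ℤ) + 1) • k) := by
      intro h
      have := h.2
      rw [hg] at this
      norm_num at this
    have hex : ∃ k', ZStar k' ∧ (((1 : ℕ) : ℤ) + 1) • k = (2 : ℤ) • k' := ⟨k, hk, by norm_num⟩
    rw [if_neg hns, dif_pos hex]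
    have := hex.choose_spec.2
    have h2 : hex.choose = k := by
      ext i
      have := congrFun this i
      simp at this
      omega
    rw [h2]
    simp
  · have hns : ¬ ZStar (((j : ℤ) + 1) • k) := by
      intro h
      have := h.2
      rw [hg] at this
      omega
    have hex : ¬ ∃ k', ZStar k' ∧ ((j : ℤ) + 1) • k = (2 : ℤ) • k' := by
      rintro ⟨k', hk', e⟩
      have := gcd_smul_star hk' 1
      have e2 : (((1 : ℕ) : ℤ) + 1) • k' = (2 : ℤ) • k' := by norm_num
      rw [e2, ← e, hg] at this
      push_cast at this
      omega
    rw [if_neg hns, dif_neg hex, if_neg (by omega), if_neg (by omega)]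

lemma norm_pertAll_le {n : ℕ} {L0 L1 : (Fin n → ℤ) → ℂ} {ε : ℝ} (hε : 0 ≤ ε)
    (h0 : ∀ k, ‖L0 k‖ ≤ ε) (h1 : ∀ k, ‖L1 k‖ ≤ ε) (q : Fin n → ℤ) : ‖pertAll L0 L1 q‖ ≤ ε := by
  unfold pertAll
  split_ifs
  · exact h0 _
  · exact h1 _
  · simpa using hε

lemma dense_Pprime (n : ℕ) {c s : ℝ} (hs : 0 < s) :
    Metric.closedBall (0 : XSp n) 1 ⊆
        closure (Pprime n c s ∩ Metric.closedBall (0 : XSp n) 1) := by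
  classical
  intro z hz
  rw [mem_closedBall_zero_iff] at hz
  rw [Metric.mem_closure_iff]
  intro ε₀ hε₀
  obtain ⟨ε, hε, hε1, hεlt⟩ : ∃ ε : ℝ, 0 < ε ∧ ε ≤ 1 / 2 ∧ 2 * ε < ε₀ :=
    ⟨min (1 / 2) (ε₀ / 4), by positivity, min_le_left _ _, by
      have := min_le_right (1 / 2) (ε₀ / 4); linarith⟩
  have hzq : ∀ q, ‖z q‖ ≤ 1 := fun q => (lp.norm_apply_le_norm (by simp) z q).trans hz
  have hex : ∀ k : Fin n → ℤ, ∃ l : ℂ × ℂ, ‖l.1‖ ≤ ε ∧ ‖l.2‖ ≤ ε ∧ ∀ hk : ZSharp k,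
      NiceF (Fr 0 ((onormZ k : ℝ) * s) (fun j => ((1 - ε : ℝ) : ℂ) * seqOf z k hk j + pertSeq l.1 l.2 j))
        (Fr 1 ((onormZ k : ℝ) * s) (fun j => ((1 - ε : ℝ) : ℂ) * seqOf z k hk j + pertSeq l.1 l.2 j))
        (Fr 2 ((onormZ k : ℝ) * s) (fun j => ((1 - ε : ℝ) : ℂ) * seqOf z k hk j + pertSeq l.1 l.2 j)) := by
    intro k
    by_cases hk : ZSharp k
    · have hσ : 0 < (onormZ k : ℝ) * s := mul_pos (by exact_mod_cast onormZ_pos hk) hs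
      obtain ⟨a, b, h1, h2, h3⟩ := exists_pert hσ
        (w := fun j => ((1 - ε : ℝ) : ℂ) * seqOf z k hk j) (C := ‖((1 - ε : ℝ) : ℂ)‖ * ‖z‖)
        (fun j => by
          rw [norm_mul]
          exact mul_le_mul_of_nonneg_left (norm_seqOf_le z k hk j) (norm_nonneg _)) hε
      exact ⟨(a, b), h1, h2, fun _ => h3⟩
    · exact ⟨0, by simpa using hε.le, by simpa using hε.le, fun h => absurd h hk⟩
  choose l hl1 hl2 hN using hex
  set K := Ks c s ε with hK
  let g : {k : Fin n → ℤ // ZSharp k} → ℂ := fun q =>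
    if ZStar q.1 ∧ K < (onormZ q.1 : ℝ) then (if ‖z q‖ < ε then (ε : ℂ) else z q)
    else ((1 - ε : ℝ) : ℂ) * z q + pertAll (fun k => (l k).1) (fun k => (l k).2) q.1
  have hpert : ∀ q, ‖pertAll (fun k => (l k).1) (fun k => (l k).2) q‖ ≤ ε :=
    norm_pertAll_le hε.le hl1 hl2
  have hn1 : ‖((1 - ε : ℝ) : ℂ)‖ = 1 - ε := by
    rw [Complex.norm_real, Real.norm_of_nonneg (by linarith)]
  have hnε : ‖(ε : ℂ)‖ = ε := by
    rw [Complex.norm_real, Real.norm_of_nonneg hε.le]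
  have hg1 : ∀ q, ‖g q‖ ≤ 1 := by
    intro q
    simp only [g]
    split_ifs
    · rw [hnε]; linarith
    · exact hzq q
    · refine (norm_add_le _ _).trans ?_
      rw [norm_mul, hn1]
      have := hpert q.1
      have := mul_le_mul_of_nonneg_left (hzq q) (by linarith : 0 ≤ 1 - ε)
      linarith
  have hgz : ∀ q, ‖z q - g q‖ ≤ 2 * ε := by
    intro q
    simp only [g]
    split_ifs with h1 h2
    · refine (norm_sub_le _ _).trans ?_
      rw [hnε]; linarith
    · simp; linarith
    · have : z q - (((1 - ε : ℝ) : ℂ) * z q + pertAll (fun k => (l k).1) (fun k => (l k).2) q.1) =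
        (ε : ℂ) * z q - pertAll (fun k => (l k).1) (fun k => (l k).2) q.1 := by push_cast; ring
      rw [this]
      refine (norm_sub_le _ _).trans ?_
      rw [norm_mul, hnε]
      have := hpert q.1
      have := mul_le_mul_of_nonneg_left (hzq q) hε.le
      linarith
  let z' : XSp n := ⟨g, memℓp_infty ⟨1, by rintro _ ⟨q, rfl⟩; exact hg1 q⟩⟩
  have hz' : ∀ q, z' q = g q := fun _ => rfl
  refine ⟨z', ⟨?_, ?_⟩, ?_⟩
  · refine (Pprime_iff hs z').2 ⟨ε, hε, by linarith, ?_, ?_⟩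
    · intro k hk hkK
      rw [hz']
      simp only [g]
      rw [if_pos ⟨hk, hkK⟩]
      split_ifs with h
      · rw [hnε]
      · exact not_lt.1 h
    · intro k hk hkK
      have hseq : seqOf z' k hk.1 = fun j => ((1 - ε : ℝ) : ℂ) * seqOf z k hk.1 j +
          pertSeq (l k).1 (l k).2 j := by
        ext j
        have : seqOf z' k hk.1 j = g ⟨((j : ℤ) + 1) • k, zsharp_smul hk.1 j⟩ := rfl
        rw [this]
        simp only [g]
        rw [if_neg, pertAll_ray _ _ hk]
        · rfl
        · rintro ⟨h1, h2⟩
          have h3 := h1.2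
          rw [gcd_smul_star hk] at h3
          have h4 : j = 0 := by omega
          subst h4
          simp at h2
          linarith
      unfold GoodK
      rw [hseq]
      exact hN k hk.1
  · rw [mem_closedBall_zero_iff]
    exact lp.norm_le_of_forall_le zero_le_one hg1
  · rw [dist_eq_norm]
    refine lt_of_le_of_lt (lp.norm_le_of_forall_le (by positivity) (C := 2 * ε) ?_) hεlt
    intro q
    exact hgz q

theorem stmt_18 (n : ℕ) (hn : 2 ≤ n) (s : ℝ) (hs : 0 < s) (c : ℝ) (hc : 1 ≤ c) :
    IsOpen (Pprime n c s) ∧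
      Metric.closedBall (0 : XSp n) 1 ⊆
        closure (Pprime n c s ∩ Metric.closedBall (0 : XSp n) 1) := by
  exact ⟨isOpen_Pprime n hs hc, dense_Pprime n hs⟩
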